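/- The basic monogenic functions satisfy the Appell-type property ∂X_{n,m}^{±} = 2(n+m+1) X_{n-1,m}^{±}, valid for n ≥ 0 with 0 ≤ m ≤ n, and also for n ≤ -3 with 0 ≤ m ≤ -n-2. -/

import Mathlib

open MeasureTheory Real

noncomputable section

/-- Euclidean space `ℝ³` with coordinates `x 0, x 1, x 2`. -/
abbrev E3 := EuclideanSpace ℝ (Fin 3)

/-- Legendre polynomial of degree `n` via Rodrigues' formula. -/
def legendreP (n : ℕ) (t : ℝ) : ℝ :=
  (1 / (2 ^ n * n.factorial : ℝ)) * iteratedDeriv n (fun s : ℝ => (s ^ 2 - 1) ^ n) t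

/-- Associated Legendre function of nonnegative integer degree `n` and order `m`
(Ferrers-type definition, no Condon–Shortley phase):
`P_n^m(t) = (1-t²)^{m/2} (d/dt)^m P_n(t)`. -/
def assocLegendreNat (n m : ℕ) (t : ℝ) : ℝ :=
  (1 - t ^ 2) ^ ((m : ℝ) / 2) * iteratedDeriv m (legendreP n) t

/-- Associated Legendre function of arbitrary integer degree, using the
reflection `P_{-n}^m = P_{n-1}^m` for negative degrees. -/
def assocLegendre (n : ℤ) (m : ℕ) (t : ℝ) : ℝ :=
  if 0 ≤ n then assocLegendreNat n.toNat m t else assocLegendreNat (-n - 1).toNat m t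

/-- Spherical radius `ρ`. -/
def sphRho (x : E3) : ℝ := Real.sqrt (x 0 ^ 2 + x 1 ^ 2 + x 2 ^ 2)

/-- Azimuthal angle `φ` of the point `(x₁, x₂)`. -/
def sphPhi (x : E3) : ℝ := Complex.arg ⟨x 1, x 2⟩

/-- Azimuthal factor `Φ_m^±(φ)`; `sgn = true` corresponds to `+` (cosine),
`sgn = false` to `−` (sine). -/
def PhiFac (m : ℕ) (sgn : Bool) (φ : ℝ) : ℝ :=
  if sgn then Real.cos (m * φ) else Real.sin (m * φ)

/-- Solid spherical harmonic `U_{n,m}^{±}(x) = ρ^n P_n^m(cos θ) Φ_m^{±}(φ)`. -/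
def solidU (n : ℤ) (m : ℕ) (sgn : Bool) (x : E3) : ℝ :=
  sphRho x ^ n * assocLegendre n m (x 0 / sphRho x) * PhiFac m sgn (sphPhi x)

/-- The exterior `B^e` of the closed unit ball in `ℝ³`. -/
def extB : Set E3 := {x : E3 | 1 < ‖x‖}

/-- The quaternions; the subspace `𝒜 = ℝ + ℝe₁ + ℝe₂` consists of those
quaternions with `imK = 0`. -/
abbrev H := Quaternion ℝ

def qe1 : H := ⟨0, 1, 0, 0⟩
def qe2 : H := ⟨0, 0, 1, 0⟩

/-- Partial derivative `∂/∂xᵢ` of a quaternion-valued function. -/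
def pd (i : Fin 3) (f : E3 → H) (x : E3) : H :=
  fderiv ℝ f x (EuclideanSpace.single i 1)

/-- The Cauchy–Riemann (Fueter) operator `∂̄ = ∂/∂x₀ + e₁∂/∂x₁ + e₂∂/∂x₂`. -/
def Dbar (f : E3 → H) (x : E3) : H := pd 0 f x + qe1 * pd 1 f x + qe2 * pd 2 f x

/-- The conjugate Fueter operator `∂ = ∂/∂x₀ − e₁∂/∂x₁ − e₂∂/∂x₂`. -/
def Dop (f : E3 → H) (x : E3) : H := pd 0 f x - qe1 * pd 1 f x - qe2 * pd 2 f x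

/-- The solid harmonic `U_{n,m}^±` regarded as a quaternion-valued function. -/
def solidUq (n : ℤ) (m : ℕ) (sgn : Bool) (x : E3) : H := ((solidU n m sgn x : ℝ) : H)

/-- The basic spherical monogenic `X_{n,m}^{±} = ∂U_{n+1,m}^{±}`. -/
def Xmon (n : ℤ) (m : ℕ) (sgn : Bool) : E3 → H := Dop (solidUq (n + 1) m sgn)

/-- The scalar inner product on `𝒜`-valued quaternions:
`⟨p,q⟩ = p₀q₀ + p₁q₁ + p₂q₂`. -/
def qip (p q : H) : ℝ := p.re * q.re + p.imI * q.imI + p.imJ * q.imJ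



open Polynomial in
/-- Rodrigues powers. -/
def rodW (k : ℕ) : Polynomial ℝ := (X ^ 2 - 1) ^ k

open Polynomial in
def rodD (k j : ℕ) : Polynomial ℝ := derivative^[j] (rodW k)

open Polynomial in
lemma rodD_der (k j : ℕ) : derivative (rodD k j) = rodD k (j + 1) := by
  simp [rodD, Function.iterate_succ_apply']

open Polynomial in
lemma rodW_der (k : ℕ) : derivative (rodW (k + 1)) = 2 * ((k : ℝ[X]) + 1) * (X * rodW k) := by
  simp only [rodW, derivative_pow, derivative_sub, derivative_X, derivative_one, map_natCast, map_add, map_one]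
  simp
  ring

open Polynomial in
lemma rod_shift (k j : ℕ) : rodD (k + 1) (j + 2) =
    2 * ((k : ℝ[X]) + 1) * (X * rodD k (j + 1) + ((j : ℝ[X]) + 1) * rodD k j) := by
  induction j with
  | zero =>
    rw [← rodD_der, ← rodD_der]
    have : rodD (k + 1) 0 = rodW (k + 1) := rfl
    rw [this, rodW_der, ← rodD_der]
    have : rodD k 0 = rodW k := rfl
    rw [this]
    have h2 : derivative (2 : ℝ[X]) = 0 := by simpa using derivative_natCast (R := ℝ) (n := 2)
    simp only [derivative_mul, derivative_add, derivative_sub, derivative_X_pow, derivative_X, derivative_one, derivative_natCast, h2, rodD_der, derivative_zero]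
    rw [show derivative (rodW k) = rodD k (0+1) from rfl, show rodW k = rodD k 0 from rfl]
    push_cast
    ring
  | succ j ih =>
    rw [← rodD_der, ih]
    have h2 : derivative (2 : ℝ[X]) = 0 := by simpa using derivative_natCast (R := ℝ) (n := 2)
    simp only [derivative_mul, derivative_add, derivative_sub, derivative_X_pow, derivative_X, derivative_one, derivative_natCast, h2, rodD_der, derivative_zero]
    push_cast
    ring

open Polynomial in
lemma rod_base (k : ℕ) : (X ^ 2 - 1) * rodD k 1 = 2 * (k : ℝ[X]) * X * rodD k 0 := by
  have h0 : rodD k 0 = rodW k := rfl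
  have h1 : rodD k 1 = derivative (rodW k) := rfl
  rw [h0, h1]
  cases k with
  | zero => simp [rodW]
  | succ k =>
    rw [rodW_der]
    simp only [rodW, pow_succ]
    push_cast
    ring

open Polynomial in
lemma rod_ode (k j : ℕ) : (X ^ 2 - 1) * rodD k (j + 2) + 2 * ((j : ℝ[X]) + 1) * X * rodD k (j + 1)
    + ((j : ℝ[X]) + 1) * (j : ℝ[X]) * rodD k j
    = 2 * (k : ℝ[X]) * (X * rodD k (j + 1) + ((j : ℝ[X]) + 1) * rodD k j) := by
  have h2 : derivative (2 : ℝ[X]) = 0 := by simpa using derivative_natCast (R := ℝ) (n := 2)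
  induction j with
  | zero =>
    have := congrArg derivative (rod_base k)
    simp only [derivative_mul, derivative_add, derivative_sub, derivative_X_pow, derivative_X, derivative_one, derivative_natCast, h2, rodD_der, derivative_zero] at this
    push_cast at this ⊢
    simp at this ⊢
    have hC2 : (C 2 : ℝ[X]) = 2 := rfl
    rw [hC2] at this
    linear_combination this
  | succ j ih =>
    have := congrArg derivative ih
    simp only [derivative_mul, derivative_add, derivative_sub, derivative_X_pow, derivative_X, derivative_one, derivative_natCast, h2, rodD_der, derivative_zero] at this
    push_cast at this
    simp only [map_ofNat, pow_one, Nat.cast_ofNat, Nat.add_one_sub_one] at this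
    push_cast
    linear_combination this

open Polynomial in
lemma rod_prod (k j : ℕ) : rodD (k + 1) (j + 2) = (X ^ 2 - 1) * rodD k (j + 2)
    + 2 * ((j : ℝ[X]) + 2) * X * rodD k (j + 1) + ((j : ℝ[X]) + 2) * ((j : ℝ[X]) + 1) * rodD k j := by
  rw [rod_shift]
  linear_combination -rod_ode k j

open Polynomial in
/-- `Q_{k,m}`: the `m`-th derivative of the Legendre polynomial. -/
def legQ (k m : ℕ) : Polynomial ℝ := C (1 / (2 ^ k * k.factorial : ℝ)) * rodD k (k + m)

open Polynomial in
lemma legQ_der (k m : ℕ) : derivative (legQ k m) = legQ k (m + 1) := by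
  simp [legQ, rodD_der, add_assoc]

open Polynomial in
lemma C_rel (k : ℕ) : C (1 / (2 ^ k * k.factorial : ℝ)) =
    2 * ((k : ℝ[X]) + 1) * C (1 / (2 ^ (k + 1) * (k + 1).factorial : ℝ)) := by
  have h1 : (2 * ((k : ℝ[X]) + 1)) = C (2 * ((k : ℝ) + 1)) := by rw [C_mul, C_add, C_1, map_natCast, map_ofNat]
  rw [h1, ← C_mul]
  congr 1
  have : (k.factorial : ℝ) ≠ 0 := by positivity
  have : (k : ℝ) + 1 ≠ 0 := by positivity
  rw [Nat.factorial_succ]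
  push_cast
  rw [pow_succ]
  field_simp

open Polynomial in
lemma legQ_ode (k m : ℕ) : (X ^ 2 - 1) * legQ k (m + 2) + 2 * ((m : ℝ[X]) + 1) * X * legQ k (m + 1)
    + ((k : ℝ[X]) + (m : ℝ[X]) + 1) * ((m : ℝ[X]) - (k : ℝ[X])) * legQ k m = 0 := by
  have := rod_ode k (k + m)
  push_cast at this
  simp only [legQ, ← add_assoc]
  linear_combination C (1 / (2 ^ k * k.factorial : ℝ)) * this

open Polynomial in
lemma legQ_shift (k m : ℕ) : legQ (k + 1) (m + 1) = X * legQ k (m + 1)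
    + ((k : ℝ[X]) + (m : ℝ[X]) + 1) * legQ k m := by
  have := rod_shift k (k + m)
  simp only [legQ, C_rel k]
  rw [show k + 1 + (m + 1) = k + m + 2 by ring, this]
  push_cast
  rw [← add_assoc]
  ring

open Polynomial in
lemma legQ_up (k m : ℕ) : ((k : ℝ[X]) + 1 - (m : ℝ[X])) * legQ (k + 1) m = (X ^ 2 - 1) * legQ k (m + 1)
    + ((k : ℝ[X]) + (m : ℝ[X]) + 1) * X * legQ k m := by
  simp only [legQ, C_rel k]
  rw [show k + 1 + m = k + m + 1 by ring, ← add_assoc]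
  obtain ⟨j, hj⟩ | hj : (∃ j, k + m = j + 1) ∨ k + m = 0 := by
    rcases Nat.eq_zero_or_eq_succ_pred (k + m) with h | h
    · exact Or.inr h
    · exact Or.inl ⟨_, h⟩
  · rw [hj]
    have hc : (m : ℝ[X]) = (j : ℝ[X]) + 1 - (k : ℝ[X]) := by
      have : ((k + m : ℕ) : ℝ[X]) = ((j + 1 : ℕ) : ℝ[X]) := by rw [hj]
      push_cast at this
      linear_combination this
    have e1 := rod_shift k j
    have e2 := rod_prod k j
    rw [hc]
    linear_combination C (1 / (2 ^ (k + 1) * (k + 1).factorial : ℝ)) *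
      (2 * ((k : ℝ[X]) + 1) * e2 - ((j : ℝ[X]) + 2) * e1)
  · obtain ⟨rfl, rfl⟩ : k = 0 ∧ m = 0 := by omega
    have h := rodW_der 0
    have h0 : rodD 1 (0 + 0 + 1) = derivative (rodW (0 + 1)) := rfl
    have h1 : rodD 0 (0 + 0 + 1) = 0 := by
      show derivative (rodW 0) = 0
      simp [rodW]
    have h2 : rodD 0 (0 + 0) = rodW 0 := rfl
    simp only [zero_add] at h h0 h1 h2 ⊢
    rw [h0, h1, h2, h]
    push_cast
    ring

open Polynomial in
lemma legQ_down (k m : ℕ) : ((k : ℝ[X]) + 1 - (m : ℝ[X])) * X * legQ (k + 1) m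
    + (1 - X ^ 2) * legQ (k + 1) (m + 1) = ((k : ℝ[X]) + (m : ℝ[X]) + 1) * legQ k m := by
  linear_combination X * legQ_up k m + (1 - X ^ 2) * legQ_shift k m

open Polynomial in
lemma iteratedDeriv_poly (p : ℝ[X]) (n : ℕ) :
    iteratedDeriv n (fun t => p.eval t) = fun t => (derivative^[n] p).eval t := by
  induction n with
  | zero => simp
  | succ n ih =>
    rw [iteratedDeriv_succ, ih, Function.iterate_succ_apply']
    funext t
    simp

open Polynomial in
lemma iter_legQ (k m : ℕ) (t : ℝ) : iteratedDeriv m (legendreP k) t = (legQ k m).eval t := by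
  have h0 : legendreP k = fun t => (legQ k 0).eval t := by
    funext t
    have h := congrFun (iteratedDeriv_poly (rodW k) k) t
    have h' : (fun t => (rodW k).eval t) = fun s : ℝ => (s ^ 2 - 1) ^ k := by
      funext s; simp [rodW]
    rw [h'] at h
    simp only [legendreP, legQ, h, rodD, eval_mul, eval_C, add_zero]
  rw [h0, iteratedDeriv_poly]
  have : ∀ m, derivative^[m] (legQ k 0) = legQ k m := by
    intro m
    induction m with
    | zero => rfl
    | succ m ih => rw [Function.iterate_succ_apply', ih, legQ_der]
  rw [this]

/-- gradient predicate -/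
def HasG (u : E3 → ℝ) (y : E3) (a b c : ℝ) : Prop :=
  HasFDerivAt u (a • (EuclideanSpace.proj 0 : E3 →L[ℝ] ℝ) + b • (EuclideanSpace.proj 1 : E3 →L[ℝ] ℝ)
    + c • (EuclideanSpace.proj 2 : E3 →L[ℝ] ℝ)) y

lemma HasG.congr {u : E3 → ℝ} {y : E3} {a b c a' b' c' : ℝ} (h : HasG u y a b c)
    (ha : a = a') (hb : b = b') (hc : c = c') : HasG u y a' b' c' := by
  subst ha hb hc; exact h

lemma HasG.uniq {u : E3 → ℝ} {y : E3} {a b c a' b' c' : ℝ} (h : HasG u y a b c)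
    (h' : HasG u y a' b' c') : a = a' ∧ b = b' ∧ c = c' := by
  have := HasFDerivAt.unique h h'
  have e0 := DFunLike.congr_fun this (EuclideanSpace.single 0 1)
  have e1 := DFunLike.congr_fun this (EuclideanSpace.single 1 1)
  have e2 := DFunLike.congr_fun this (EuclideanSpace.single 2 1)
  simp at e0 e1 e2
  exact ⟨e0, e1, e2⟩

lemma HasG.mul {u v : E3 → ℝ} {y : E3} {a b c a' b' c' : ℝ} (h : HasG u y a b c)
    (h' : HasG v y a' b' c') : HasG (fun y => u y * v y) y (a * v y + u y * a')
      (b * v y + u y * b') (c * v y + u y * c') := by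
  unfold HasG at *
  refine (HasFDerivAt.mul h h').congr_fderiv ?_
  ext z
  simp
  ring

lemma HasG.add {u v : E3 → ℝ} {y : E3} {a b c a' b' c' : ℝ} (h : HasG u y a b c)
    (h' : HasG v y a' b' c') : HasG (fun y => u y + v y) y (a + a') (b + b') (c + c') := by
  unfold HasG at *
  refine (HasFDerivAt.add h h').congr_fderiv ?_
  ext z
  simp
  ring

lemma HasG.const (r : ℝ) (y : E3) : HasG (fun _ => r) y 0 0 0 := by
  unfold HasG
  refine (hasFDerivAt_const r y).congr_fderiv ?_
  ext z
  simp

lemma HasG.coord0 (y : E3) : HasG (fun y => y 0) y 1 0 0 := by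
  unfold HasG
  refine ((EuclideanSpace.proj 0 : E3 →L[ℝ] ℝ).hasFDerivAt (x := y)).congr_fderiv ?_
  ext z
  simp

lemma HasG.coord1 (y : E3) : HasG (fun y => y 1) y 0 1 0 := by
  unfold HasG
  refine ((EuclideanSpace.proj 1 : E3 →L[ℝ] ℝ).hasFDerivAt (x := y)).congr_fderiv ?_
  ext z
  simp

lemma HasG.coord2 (y : E3) : HasG (fun y => y 2) y 0 0 1 := by
  unfold HasG
  refine ((EuclideanSpace.proj 2 : E3 →L[ℝ] ℝ).hasFDerivAt (x := y)).congr_fderiv ?_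
  ext z
  simp

lemma HasG.comp {u : E3 → ℝ} {y : E3} {a b c g' : ℝ} {g : ℝ → ℝ} (hg : HasDerivAt g g' (u y))
    (h : HasG u y a b c) : HasG (fun y => g (u y)) y (g' * a) (g' * b) (g' * c) := by
  unfold HasG at *
  refine (hg.comp_hasFDerivAt y h).congr_fderiv ?_
  ext z
  simp
  ring

lemma rho_sq_pos {y : E3} (hy : y ≠ 0) : 0 < y 0 ^ 2 + y 1 ^ 2 + y 2 ^ 2 := by
  by_contra hc
  apply hy
  have h0 : y 0 = 0 := by nlinarith [sq_nonneg (y 0), sq_nonneg (y 1), sq_nonneg (y 2)]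
  have h1 : y 1 = 0 := by nlinarith [sq_nonneg (y 0), sq_nonneg (y 1), sq_nonneg (y 2)]
  have h2 : y 2 = 0 := by nlinarith [sq_nonneg (y 0), sq_nonneg (y 1), sq_nonneg (y 2)]
  ext i
  fin_cases i <;> simp [h0, h1, h2]

lemma rho_pos {y : E3} (hy : y ≠ 0) : 0 < sphRho y := Real.sqrt_pos.2 (rho_sq_pos hy)

lemma rho_sq (y : E3) : sphRho y ^ 2 = y 0 ^ 2 + y 1 ^ 2 + y 2 ^ 2 :=
  Real.sq_sqrt (by positivity)

lemma HasG.rho {y : E3} (hy : y ≠ 0) :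
    HasG sphRho y (y 0 / sphRho y) (y 1 / sphRho y) (y 2 / sphRho y) := by
  have h := (((HasG.coord0 y).mul (HasG.coord0 y)).add ((HasG.coord1 y).mul (HasG.coord1 y))).add
    ((HasG.coord2 y).mul (HasG.coord2 y))
  have hp := rho_sq_pos hy
  have e : sphRho = fun y : E3 => Real.sqrt (y 0 * y 0 + y 1 * y 1 + y 2 * y 2) := by
    funext y; simp [sphRho, sq]
  have hs := Real.hasDerivAt_sqrt (x := y 0 * y 0 + y 1 * y 1 + y 2 * y 2) (by nlinarith)
  have h2 := HasG.comp hs h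
  have e' : √(y 0 * y 0 + y 1 * y 1 + y 2 * y 2) = sphRho y := by rw [e]
  have := rho_pos hy
  rw [e'] at h2
  rw [← e] at h2
  refine h2.congr ?_ ?_ ?_ <;> field_simp <;> ring

open Polynomial in
def RR (a : ℤ) (q : ℝ[X]) (y : E3) : ℝ := sphRho y ^ a * q.eval (y 0 / sphRho y)

open Polynomial in
def opA (a : ℤ) (q : ℝ[X]) : ℝ[X] := (a : ℝ[X]) * X * q + (1 - X ^ 2) * derivative q

open Polynomial in
def opB (a : ℤ) (q : ℝ[X]) : ℝ[X] := (a : ℝ[X]) * q - X * derivative q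

open Polynomial in
lemma HasG.RR {y : E3} (hy : y ≠ 0) (a : ℤ) (q : ℝ[X]) :
    HasG (RR a q) y (_root_.RR (a - 1) (opA a q) y) (y 1 * _root_.RR (a - 2) (opB a q) y)
      (y 2 * _root_.RR (a - 2) (opB a q) y) := by
  have hr := HasG.rho hy
  have hp := rho_pos hy
  have hz := HasG.comp (hasDerivAt_zpow a (sphRho y) (Or.inl hp.ne')) hr
  have hi := HasG.comp (hasDerivAt_inv hp.ne') hr
  have ht := (HasG.coord0 y).mul hi
  have hq := HasG.comp (q.hasDerivAt (y 0 * (sphRho y)⁻¹)) ht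
  have h := hz.mul hq
  have e1 : sphRho y ^ (a - 1) = sphRho y ^ a / sphRho y := by
    rw [zpow_sub₀ hp.ne', zpow_one]
  have e2 : sphRho y ^ (a - 2) = sphRho y ^ a / sphRho y ^ 2 := by
    rw [zpow_sub₀ hp.ne']; rfl
  have hs := rho_sq y
  have e : _root_.RR a q = fun y => sphRho y ^ a * q.eval (y 0 * (sphRho y)⁻¹) := by
    funext y; simp [_root_.RR, div_eq_mul_inv]
  rw [e]
  refine h.congr ?_ ?_ ?_ <;> simp only [_root_.RR, opA, opB, eval_add, eval_sub, eval_mul, eval_X,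
    eval_one, eval_pow, eval_intCast, e1, e2, div_eq_mul_inv] <;> field_simp <;> ring

/-- planar harmonic data -/
structure Planar (m : ℕ) (W W1 W2 W11 W12 : E3 → ℝ) : Prop where
  h0 : ∀ y, HasG W y 0 (W1 y) (W2 y)
  h1 : ∀ y, HasG W1 y 0 (W11 y) (W12 y)
  h2 : ∀ y, HasG W2 y 0 (W12 y) (-W11 y)
  euler : ∀ y, y 1 * W1 y + y 2 * W2 y = m * W y

def zz (y : E3) : ℂ := ⟨y 1, y 2⟩
def Wc (m : ℕ) (y : E3) : ℝ := (zz y ^ m).re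
def Ws (m : ℕ) (y : E3) : ℝ := (zz y ^ m).im

lemma Wc_succ (m : ℕ) (y : E3) : Wc (m + 1) y = y 1 * Wc m y + (-1) * (y 2 * Ws m y) := by
  simp [Wc, Ws, pow_succ, zz]; ring
lemma Ws_succ (m : ℕ) (y : E3) : Ws (m + 1) y = y 1 * Ws m y + y 2 * Wc m y := by
  simp [Wc, Ws, pow_succ, zz]; ring

lemma W_grad (m : ℕ) (y : E3) :
    HasG (Wc m) y 0 (m * Wc (m - 1) y) (-(m * Ws (m - 1) y)) ∧
    HasG (Ws m) y 0 (m * Ws (m - 1) y) (m * Wc (m - 1) y) := by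
  induction m with
  | zero =>
    have e1 : Wc 0 = fun _ => 1 := by funext y; simp [Wc]
    have e2 : Ws 0 = fun _ => 0 := by funext y; simp [Ws]
    rw [e1, e2]
    exact ⟨(HasG.const 1 y).congr rfl (by simp) (by simp), (HasG.const 0 y).congr rfl (by simp) (by simp)⟩
  | succ m ih =>
    obtain ⟨hc, hs⟩ := ih
    have e1 : Wc (m + 1) = fun y => y 1 * Wc m y + (-1) * (y 2 * Ws m y) := funext (Wc_succ m)
    have e2 : Ws (m + 1) = fun y => y 1 * Ws m y + y 2 * Wc m y := funext (Ws_succ m)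
    rw [e1, e2]
    have k1 : (m : ℝ) * Wc m y = m * (y 1 * Wc (m - 1) y + (-1) * (y 2 * Ws (m - 1) y)) := by
      cases m with
      | zero => simp
      | succ m => rw [Wc_succ]; simp
    have k2 : (m : ℝ) * Ws m y = m * (y 1 * Ws (m - 1) y + y 2 * Wc (m - 1) y) := by
      cases m with
      | zero => simp
      | succ m => rw [Ws_succ]; simp
    constructor
    · refine (((HasG.coord1 y).mul hc).add ((HasG.const (-1) y).mul ((HasG.coord2 y).mul hs))).congr ?_ ?_ ?_
      · ring
      · push_cast; try simp only [add_tsub_cancel_right]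
        linear_combination -k1
      · push_cast; try simp only [add_tsub_cancel_right]
        linear_combination k2
    · refine (((HasG.coord1 y).mul hs).add ((HasG.coord2 y).mul hc)).congr ?_ ?_ ?_
      · ring
      · push_cast; try simp only [add_tsub_cancel_right]
        linear_combination -k2
      · push_cast; try simp only [add_tsub_cancel_right]
        linear_combination -k1

lemma HasG.smul {u : E3 → ℝ} {y : E3} {a b c : ℝ} (r : ℝ) (h : HasG u y a b c) :
    HasG (fun y => r * u y) y (r * a) (r * b) (r * c) :=
  ((HasG.const r y).mul h).congr (by ring) (by ring) (by ring)

lemma planar_c (m : ℕ) : ∃ W1 W2 W11 W12, Planar m (Wc m) W1 W2 W11 W12 := by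
  refine ⟨fun y => m * Wc (m - 1) y, fun y => (-m) * Ws (m - 1) y,
    fun y => m * ((m - 1 : ℕ) * Wc (m - 1 - 1) y), fun y => (-m) * ((m - 1 : ℕ) * Ws (m - 1 - 1) y), ?_, ?_, ?_, ?_⟩
  · intro y; exact (W_grad m y).1.congr rfl rfl (by ring)
  · intro y; exact ((W_grad (m - 1) y).1.smul m).congr (by ring) rfl (by ring)
  · intro y; exact ((W_grad (m - 1) y).2.smul (-m)).congr (by ring) rfl (by ring)
  · intro y
    cases m with
    | zero => simp
    | succ m => rw [Wc_succ]; simp; ring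

lemma planar_s (m : ℕ) : ∃ W1 W2 W11 W12, Planar m (Ws m) W1 W2 W11 W12 := by
  refine ⟨fun y => m * Ws (m - 1) y, fun y => m * Wc (m - 1) y,
    fun y => m * ((m - 1 : ℕ) * Ws (m - 1 - 1) y), fun y => m * ((m - 1 : ℕ) * Wc (m - 1 - 1) y), ?_, ?_, ?_, ?_⟩
  · intro y; exact (W_grad m y).2.congr rfl rfl (by ring)
  · intro y; exact ((W_grad (m - 1) y).2.smul m).congr (by ring) rfl (by ring)
  · intro y; exact ((W_grad (m - 1) y).1.smul m).congr (by ring) rfl (by ring)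
  · intro y
    cases m with
    | zero => simp
    | succ m => rw [Ws_succ]; simp; ring

def WW (m : ℕ) (sgn : Bool) : E3 → ℝ := if sgn then Wc m else Ws m

lemma planar_W (m : ℕ) (sgn : Bool) : ∃ W1 W2 W11 W12, Planar m (WW m sgn) W1 W2 W11 W12 := by
  cases sgn
  · simpa [WW] using planar_s m
  · simpa [WW] using planar_c m

/-- degree index -/
def degK (N : ℤ) : ℕ := if 0 ≤ N then N.toNat else (-N - 1).toNat

lemma polar_W (m : ℕ) (sgn : Bool) (y : E3) :
    WW m sgn y = ‖zz y‖ ^ m * PhiFac m sgn (sphPhi y) := by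
  have h : zz y ^ m = ((‖zz y‖ ^ m : ℝ) : ℂ) * (Complex.cos ((m * sphPhi y : ℝ) : ℂ) +
      Complex.sin ((m * sphPhi y : ℝ) : ℂ) * Complex.I) := by
    conv_lhs => rw [← Complex.norm_mul_cos_add_sin_mul_I (zz y)]
    rw [mul_pow, Complex.cos_add_sin_mul_I_pow]
    push_cast
    rfl
  rw [← Complex.ofReal_cos, ← Complex.ofReal_sin] at h
  cases sgn
  · show (zz y ^ m).im = ‖zz y‖ ^ m * Real.sin (m * sphPhi y)
    rw [h, Complex.im_ofReal_mul]
    simp [-Complex.ofReal_cos, -Complex.ofReal_sin]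
  · show (zz y ^ m).re = ‖zz y‖ ^ m * Real.cos (m * sphPhi y)
    rw [h, Complex.re_ofReal_mul]
    simp [-Complex.ofReal_cos, -Complex.ofReal_sin]

lemma solidU_eq (N : ℤ) (m : ℕ) (sgn : Bool) {y : E3} (hy : y ≠ 0) :
    solidU N m sgn y = RR (N - m) (legQ (degK N) m) y * WW m sgn y := by
  have hp := rho_pos hy
  have hs := rho_sq y
  have hL : assocLegendre N m (y 0 / sphRho y) = assocLegendreNat (degK N) m (y 0 / sphRho y) := by
    unfold assocLegendre degK; split_ifs <;> rfl
  have hz : ‖zz y‖ ^ 2 = y 1 ^ 2 + y 2 ^ 2 := by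
    rw [Complex.sq_norm, Complex.normSq_apply]; simp [zz]; ring
  have h1 : 1 - (y 0 / sphRho y) ^ 2 = (‖zz y‖ / sphRho y) ^ 2 := by
    rw [div_pow, div_pow, hz]; field_simp; rw [hs]; ring
  have h2 : (1 - (y 0 / sphRho y) ^ 2) ^ ((m : ℝ) / 2) = (‖zz y‖ / sphRho y) ^ m := by
    rw [h1, ← Real.rpow_natCast _ 2, ← Real.rpow_mul (by positivity), ← Real.rpow_natCast _ m]
    congr 1
    push_cast; ring
  rw [solidU, hL, assocLegendreNat, h2, iter_legQ, polar_W, RR, zpow_sub₀ hp.ne', div_pow, zpow_natCast]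
  field_simp

lemma ev_ne {x : E3} (hx : x ≠ 0) : ∀ᶠ y in nhds x, y ≠ 0 := isOpen_ne.mem_nhds hx

def mkq (a b c d : ℝ) : H := ⟨a, b, c, d⟩
lemma mkq_re (a b c d : ℝ) : (mkq a b c d).re = a := rfl
lemma mkq_imI (a b c d : ℝ) : (mkq a b c d).imI = b := rfl
lemma mkq_imJ (a b c d : ℝ) : (mkq a b c d).imJ = c := rfl
lemma mkq_imK (a b c d : ℝ) : (mkq a b c d).imK = d := rfl
lemma q_qe1 : qe1 = mkq 0 1 0 0 := rfl
lemma q_qe2 : qe2 = mkq 0 0 1 0 := rfl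
lemma mkq_congr {a b c d a' b' c' d' : ℝ} (h1 : a = a') (h2 : b = b') (h3 : c = c') (h4 : d = d') :
    mkq a b c d = mkq a' b' c' d' := by subst h1 h2 h3 h4; rfl
lemma q_add (p q : H) : p + q = mkq (p.re + q.re) (p.imI + q.imI) (p.imJ + q.imJ) (p.imK + q.imK) := rfl
lemma q_sub (p q : H) : p - q = mkq (p.re - q.re) (p.imI - q.imI) (p.imJ - q.imJ) (p.imK - q.imK) := rfl
lemma q_neg (p : H) : -p = mkq (-p.re) (-p.imI) (-p.imJ) (-p.imK) := rfl
lemma q_smul (r : ℝ) (p : H) : r • p = mkq (r * p.re) (r * p.imI) (r * p.imJ) (r * p.imK) := rfl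
lemma q_one : (1 : H) = mkq (1) (0) (0) (0) := rfl
lemma q_coe (r : ℝ) : (r : H) = mkq (r) (0) (0) (0) := rfl
lemma q_e1 (p : H) : qe1 * p = mkq (-p.imI) (p.re) (-p.imK) (p.imJ) := by
  apply Quaternion.ext <;> simp only [Quaternion.re_mul, Quaternion.imI_mul, Quaternion.imJ_mul,
    Quaternion.imK_mul] <;> simp only [q_qe1, mkq_re, mkq_imI, mkq_imJ, mkq_imK] <;> ring
lemma q_e2 (p : H) : qe2 * p = mkq (-p.imJ) (p.imK) (p.re) (-p.imI) := by
  apply Quaternion.ext <;> simp only [Quaternion.re_mul, Quaternion.imI_mul, Quaternion.imJ_mul,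
    Quaternion.imK_mul] <;> simp only [q_qe2, mkq_re, mkq_imI, mkq_imJ, mkq_imK] <;> ring

/-- assembling quaternion-valued derivatives -/
lemma quat_deriv {f0 f1 f2 : E3 → ℝ} {F : E3 → H} {y : E3} {a0 a1 a2 b0 b1 b2 c0 c1 c2 : ℝ}
    (hF : ∀ᶠ z in nhds y, F z = mkq (f0 z) (-f1 z) (-f2 z) (0))
    (h0 : HasG f0 y a0 a1 a2) (h1 : HasG f1 y b0 b1 b2) (h2 : HasG f2 y c0 c1 c2) :
    Dop F y = mkq (a0 - b1 - c2) (-b0 - a1) (-c0 - a2) (c1 - b2) := by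
  have hd := (HasFDerivAt.smul_const h0 (1 : H)).add
    ((HasFDerivAt.smul_const h1 (-qe1)).add (HasFDerivAt.smul_const h2 (-qe2)))
  have hF' : F =ᶠ[nhds y] _ := hF.mono fun z hz => show F z =
      f0 z • (1 : H) + (f1 z • (-qe1) + f2 z • (-qe2)) by
    rw [hz]
    simp only [q_add, q_smul, q_neg, q_one, q_qe1, q_qe2, mkq_re, mkq_imI, mkq_imJ, mkq_imK]
    apply mkq_congr <;> ring
  have hd' := hd.congr_of_eventuallyEq hF'
  unfold Dop pd
  rw [hd'.fderiv]
  simp only [q_e1, q_e2]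
  have k : ∀ z : E3, (ContinuousLinearMap.smulRight (a0 • (EuclideanSpace.proj 0 : E3 →L[ℝ] ℝ) +
        a1 • (EuclideanSpace.proj 1 : E3 →L[ℝ] ℝ) + a2 • (EuclideanSpace.proj 2 : E3 →L[ℝ] ℝ)) (1 : H) +
      (ContinuousLinearMap.smulRight (b0 • (EuclideanSpace.proj 0 : E3 →L[ℝ] ℝ) +
        b1 • (EuclideanSpace.proj 1 : E3 →L[ℝ] ℝ) + b2 • (EuclideanSpace.proj 2 : E3 →L[ℝ] ℝ)) (-qe1) +
      ContinuousLinearMap.smulRight (c0 • (EuclideanSpace.proj 0 : E3 →L[ℝ] ℝ) +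
        c1 • (EuclideanSpace.proj 1 : E3 →L[ℝ] ℝ) + c2 • (EuclideanSpace.proj 2 : E3 →L[ℝ] ℝ)) (-qe2))) z =
      mkq (a0 * z 0 + a1 * z 1 + a2 * z 2) (-(b0 * z 0 + b1 * z 1 + b2 * z 2))
        (-(c0 * z 0 + c1 * z 1 + c2 * z 2)) 0 := by
    intro z
    show (a0 * z 0 + a1 * z 1 + a2 * z 2) • (1 : H) + ((b0 * z 0 + b1 * z 1 + b2 * z 2) • (-qe1)
      + (c0 * z 0 + c1 * z 1 + c2 * z 2) • (-qe2)) = _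
    simp only [q_add, q_smul, q_neg, q_one, q_qe1, q_qe2, mkq_re, mkq_imI, mkq_imJ, mkq_imK]
    apply mkq_congr <;> ring
  simp only [k, q_sub, mkq_re, mkq_imI, mkq_imJ, mkq_imK]
  apply mkq_congr <;> simp <;> ring

lemma Dop_real {u : E3 → ℝ} {F : E3 → H} {y : E3} {a b c : ℝ}
    (hF : ∀ᶠ z in nhds y, F z = (u z : H)) (h : HasG u y a b c) : Dop F y = mkq (a) (-b) (-c) (0) := by
  have := quat_deriv (f0 := u) (f1 := fun _ => 0) (f2 := fun _ => 0) (F := F) (y := y)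
    (hF.mono fun z hz => by rw [hz, q_coe]; apply mkq_congr <;> simp) h (HasG.const 0 y) (HasG.const 0 y)
  rw [this]
  apply mkq_congr <;> simp

open Polynomial in
lemma leg_step (n : ℤ) (m : ℕ) (h : 0 ≤ n ∨ n ≤ -3) :
    opA (n + 1 - m) (legQ (degK (n + 1)) m) = ((n + m + 1 : ℤ) : ℝ[X]) * legQ (degK n) m := by
  unfold opA
  rw [legQ_der]
  rcases h with h | h
  · obtain ⟨k, rfl⟩ := Int.eq_ofNat_of_zero_le h
    have e1 : degK ((k : ℤ) + 1) = k + 1 := by unfold degK; rw [if_pos (by omega)]; omega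
    have e2 : degK (k : ℤ) = k := by unfold degK; rw [if_pos (by omega)]; omega
    rw [e1, e2]
    push_cast
    linear_combination legQ_down k m
  · obtain ⟨k, hk⟩ := Int.eq_ofNat_of_zero_le (show 0 ≤ -n - 2 by omega)
    obtain rfl : n = -k - 2 := by omega
    have e1 : degK (-(k : ℤ) - 2 + 1) = k := by unfold degK; rw [if_neg (by omega)]; omega
    have e2 : degK (-(k : ℤ) - 2) = k + 1 := by unfold degK; rw [if_neg (by omega)]; omega
    rw [e1, e2]
    push_cast
    linear_combination legQ_up k m

open Polynomial in
lemma leg_ode' (N : ℤ) (m : ℕ) :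
    (X ^ 2 - 1) * legQ (degK N) (m + 2) + 2 * ((m : ℝ[X]) + 1) * X * legQ (degK N) (m + 1)
    + ((N : ℝ[X]) + (m : ℝ[X]) + 1) * ((m : ℝ[X]) - (N : ℝ[X])) * legQ (degK N) m = 0 := by
  have h := legQ_ode (degK N) m
  have hN : (degK N : ℤ) = N ∨ (degK N : ℤ) = -N - 1 := by unfold degK; split_ifs <;> omega
  have hN' : ((degK N : ℕ) : ℝ[X]) = (N : ℝ[X]) ∨ ((degK N : ℕ) : ℝ[X]) = -(N : ℝ[X]) - 1 := by
    rcases hN with h | h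
    · left; exact_mod_cast congrArg (Int.cast : ℤ → ℝ[X]) h
    · right; exact_mod_cast congrArg (Int.cast : ℤ → ℝ[X]) h
  rcases hN' with e | e
  · rw [e] at h; exact h
  · rw [e] at h; linear_combination h

open Polynomial in
lemma lap_id (N : ℤ) (m : ℕ) (a : ℤ) (ha : a = N - m) (q : ℝ[X]) (hq : q = legQ (degK N) m) :
    opA (a - 1) (opA a q) + (2 + 2 * (m : ℝ[X])) * opB a q + (1 - X ^ 2) * opB (a - 2) (opB a q) = 0 := by
  subst ha hq
  have h := leg_ode' N m
  simp only [opA, opB, derivative_add, derivative_sub, derivative_mul, derivative_pow, derivative_X,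
    derivative_one, derivative_intCast, derivative_X_pow, legQ_der]
  simp
  have hC2 : (C 2 : ℝ[X]) = 2 := rfl
  rw [hC2]
  linear_combination -h

open Polynomial in
lemma comm_id (a : ℤ) (q : ℝ[X]) : opB (a - 1) (opA a q) = opA (a - 2) (opB a q) := by
  simp only [opA, opB, derivative_add, derivative_sub, derivative_mul, derivative_pow, derivative_X,
    derivative_one, derivative_intCast, derivative_X_pow]
  simp
  have hC2 : (C 2 : ℝ[X]) = 2 := rfl
  rw [hC2]
  ring

theorem stmt9 (n : ℤ) (m : ℕ) (sgn : Bool)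
    (h : (0 ≤ n ∧ (m : ℤ) ≤ n) ∨ (n ≤ -3 ∧ (m : ℤ) ≤ -n - 2))
    (x : E3) (hx : x ≠ 0) :
    Dop (Xmon n m sgn) x = ((2 * (n + (m : ℤ) + 1) : ℤ) : ℝ) • Xmon (n - 1) m sgn x := by
  have hn : 0 ≤ n ∨ n ≤ -3 := h.imp And.left And.left
  obtain ⟨W1, W2, W11, W12, hW⟩ := planar_W m sgn
  set W := WW m sgn with hWdef
  obtain ⟨a, ha⟩ : ∃ a : ℤ, a = n + 1 - m := ⟨_, rfl⟩
  obtain ⟨q, hq⟩ : ∃ q, q = legQ (degK (n + 1)) m := ⟨_, rfl⟩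
  obtain ⟨p, hp⟩ : ∃ p, p = legQ (degK n) m := ⟨_, rfl⟩
  have hstep := leg_step n m hn
  rw [← ha, ← hq, ← hp] at hstep
  have hlap := lap_id (n + 1) m a ha q hq
  have hcomm := comm_id a q
  -- first gradient
  have hU : ∀ y : E3, y ≠ 0 → HasG (fun y => RR a q y * W y) y (RR (a - 1) (opA a q) y * W y)
      (y 1 * RR (a - 2) (opB a q) y * W y + RR a q y * W1 y)
      (y 2 * RR (a - 2) (opB a q) y * W y + RR a q y * W2 y) := fun y hy =>
    ((HasG.RR hy a q).mul (hW.h0 y)).congr (by ring) rfl rfl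
  have hX : ∀ y : E3, y ≠ 0 → Xmon n m sgn y = mkq (RR (a - 1) (opA a q) y * W y) (-(y 1 * RR (a - 2) (opB a q) y * W y + RR a q y * W1 y)) (-(y 2 * RR (a - 2) (opB a q) y * W y + RR a q y * W2 y)) (0) := fun y hy => by
    refine Dop_real ?_ (hU y hy)
    filter_upwards [ev_ne hy] with z hz
    rw [solidUq, solidU_eq _ _ _ hz, ha, hq]
  have g0 := (HasG.RR hx (a - 1) (opA a q)).mul (hW.h0 x)
  have g1 := (((HasG.coord1 x).mul (HasG.RR hx (a - 2) (opB a q))).mul (hW.h0 x)).add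
    ((HasG.RR hx a q).mul (hW.h1 x))
  have g2 := (((HasG.coord2 x).mul (HasG.RR hx (a - 2) (opB a q))).mul (hW.h0 x)).add
    ((HasG.RR hx a q).mul (hW.h2 x))
  rw [quat_deriv ((ev_ne hx).mono hX) g0 g1 g2]
  -- right-hand side
  have hV := (HasG.RR hx (a - 1) p).mul (hW.h0 x)
  have hXV := Dop_real (F := solidUq (n - 1 + 1) m sgn) (by
    filter_upwards [ev_ne hx] with z hz
    rw [solidUq, solidU_eq _ _ _ hz, ha, hp, show n - 1 + 1 = n by ring, show n + 1 - (m : ℤ) - 1 = n - m by ring]) hV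
  rw [show Xmon (n - 1) m sgn x = _ from hXV, q_smul]
  have hf0 : RR (a - 1) (opA a q) = fun y => ((n + m + 1 : ℤ) : ℝ) * RR (a - 1) p y := by
    funext y; rw [hstep]; simp [RR]; ring
  obtain ⟨u0, u1, u2⟩ := HasG.uniq (HasG.RR hx (a - 1) (opA a q))
    (by rw [hf0]; exact (HasG.RR hx (a - 1) p).smul _)
  have hf := congrFun hf0 x
  -- the Laplace identity
  have hr := rho_pos hx
  have hs := rho_sq x
  have e2 : sphRho x ^ (a - 2) = sphRho x ^ (a - 2 - 2) * sphRho x ^ 2 := by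
    rw [← zpow_natCast, ← zpow_add₀ hr.ne']; congr 1; push_cast; ring
  have hL : RR (a - 1 - 1) (opA (a - 1) (opA a q)) x + (2 + 2 * m) * RR (a - 2) (opB a q) x
      + (x 1 ^ 2 + x 2 ^ 2) * RR (a - 2 - 2) (opB (a - 2) (opB a q)) x = 0 := by
    have := congrArg (Polynomial.eval (x 0 / sphRho x)) hlap
    simp only [Polynomial.eval_add, Polynomial.eval_sub, Polynomial.eval_mul, Polynomial.eval_pow,
      Polynomial.eval_X, Polynomial.eval_one, Polynomial.eval_zero, Polynomial.eval_natCast,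
      Polynomial.eval_ofNat] at this
    have h12 : x 1 ^ 2 + x 2 ^ 2 = sphRho x ^ 2 * (1 - (x 0 / sphRho x) ^ 2) := by
      field_simp; linear_combination -hs
    simp only [RR]
    rw [show a - 1 - 1 = a - 2 by ring, h12, e2]
    linear_combination sphRho x ^ (a - 2 - 2) * sphRho x ^ 2 * this
  have hC : RR (a - 1 - 2) (opB (a - 1) (opA a q)) x = RR (a - 2 - 1) (opA (a - 2) (opB a q)) x := by
    rw [hcomm, show a - 1 - 2 = a - 2 - 1 by ring]
  have hE := hW.euler x
  push_cast at *
  simp only [mkq_re, mkq_imI, mkq_imJ, mkq_imK]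
  apply mkq_congr
  · simp
    linear_combination 2 * W x * u0 - W x * hL - 2 * RR (a - 2) (opB a q) x * hE
  · simp
    linear_combination (-2) * W x * u1 - 2 * W1 x * hf + x 1 * W x * hC
  · simp
    linear_combination (-2) * W x * u2 - 2 * W2 x * hf + x 2 * W x * hC
  · simp
    ring

end
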